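/- Fix a lattice Λ ⊂ ℂ and z_1, ..., z_n ∈ ℂ. For each v ∈ ℤⁿ with v ≠ 0, define Ω_v = σ(v·z) / ( ∏_{i=1}^n σ(z_i)^{2v_i² − ∑_j v_i v_j} · ∏_{i<j} σ(z_i + z_j)^{v_i v_j} ) where v·z = v_1 z_1 + ... + v_n z_n, and set Ω_0 = 0. Then the map W : ℤⁿ → ℂ, W(v) = Ω_v, is an elliptic net, i.e., W(p+q+s)W(p−q)W(r+s)W(r) + W(q+r+s)W(q−r)W(p+s)W(p) + W(r+p+s)W(r−p)W(q+s)W(q) = 0 for all p, q, r, s ∈ ℤⁿ. -/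

import Mathlib

open Complex in
/-- The Weierstrass sigma function of a lattice, via its Weierstrass product. -/
noncomputable def wSigma (Λ : Submodule ℤ ℂ) (z : ℂ) : ℂ :=
  z * ∏' ω : {w : Λ // (w : ℂ) ≠ 0},
      (1 - z / ((ω : Λ) : ℂ)) *
        Complex.exp (z / ((ω : Λ) : ℂ) + z ^ 2 / (2 * ((ω : Λ) : ℂ) ^ 2))

/-- The net function Ω_v attached to a lattice Λ and points z₁, …, z_n, with Ω_0 = 0. -/
noncomputable def OmegaNet (Λ : Submodule ℤ ℂ) {n : ℕ} (z : Fin n → ℂ)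
    (v : Fin n → ℤ) : ℂ :=
  if v = 0 then 0 else
    wSigma Λ (∑ i, (v i : ℂ) * z i) /
      ((∏ i, wSigma Λ (z i) ^ (2 * v i ^ 2 - ∑ j, v i * v j)) *
        ∏ p ∈ Finset.univ.filter (fun p : Fin n × Fin n => p.1 < p.2),
          wSigma Λ (z p.1 + z p.2) ^ (v p.1 * v p.2))

noncomputable def wE (u : ℂ) : ℂ := (1 - u) * Complex.exp (u + u ^ 2 / 2)

lemma wE_zero : wE 0 = 1 := by simp [wE]

lemma wE_ne_zero {u : ℂ} (h : u ≠ 1) : wE u ≠ 0 :=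
  mul_ne_zero (sub_ne_zero.2 (Ne.symm h)) (Complex.exp_ne_zero _)

lemma wE_hasDerivAt (u : ℂ) : HasDerivAt wE (-u ^ 2 * Complex.exp (u + u ^ 2 / 2)) u := by
  have h1 : HasDerivAt (fun u : ℂ => 1 - u) (-1) u := (hasDerivAt_id u).const_sub 1
  have h2 : HasDerivAt (fun u : ℂ => u + u ^ 2 / 2) (1 + u) u := by
    have := (hasDerivAt_id u).add ((hasDerivAt_pow 2 u).div_const 2)
    convert! this using 1
    simp
  have := h1.mul h2.cexp
  convert! this using 1
  ring

lemma wE_differentiable : Differentiable ℂ wE := fun u => (wE_hasDerivAt u).differentiableAt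

lemma wE_bound (u : ℂ) : ‖wE u - 1‖ ≤ ‖u‖ ^ 3 * Real.exp (‖u‖ + ‖u‖ ^ 2 / 2) := by
  have := Convex.norm_image_sub_le_of_norm_hasDerivWithin_le (𝕜 := ℂ) (f := wE)
    (f' := fun u => -u ^ 2 * Complex.exp (u + u ^ 2 / 2)) (s := Metric.closedBall 0 ‖u‖)
    (C := ‖u‖ ^ 2 * Real.exp (‖u‖ + ‖u‖ ^ 2 / 2)) (x := 0) (y := u)
    (fun x _ => (wE_hasDerivAt x).hasDerivWithinAt) (fun x hx => ?_)
    (convex_closedBall _ _) (by simp) (by simp)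
  · rw [wE_zero, sub_zero] at this
    refine this.trans (le_of_eq (by ring))
  · have hx : ‖x‖ ≤ ‖u‖ := by simpa using hx
    rw [norm_mul, norm_neg, norm_pow]
    gcongr
    refine (Complex.norm_exp_le_exp_norm _).trans ?_
    gcongr
    refine (norm_add_le _ _).trans ?_
    rw [norm_div, norm_pow]
    simp only [RCLike.norm_ofNat]
    gcongr

section lat
variable (Λ : Submodule ℤ ℂ) [DiscreteTopology Λ] [IsZLattice ℝ Λ]

lemma lat_finrank : Module.finrank ℤ Λ = 2 := by
  rw [ZLattice.rank ℝ Λ, Complex.finrank_real_complex]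

lemma lat_sum : Summable fun w : Λ => ‖(w : ℂ)‖⁻¹ ^ 3 :=
  ZLattice.summable_norm_pow_inv Λ 3 (by rw [lat_finrank]; norm_num)

lemma lat_countable : (Λ : Set ℂ).Countable := by
  have : Countable Λ := by
    have := ZLattice.module_finite ℝ Λ
    have := ZLattice.module_free ℝ Λ
    exact (Module.Free.chooseBasis ℤ Λ).repr.toEquiv.countable_iff.2 inferInstance
  exact Set.countable_coe_iff.mp this

lemma lat_inv_bdd : ∃ M : ℝ, 0 ≤ M ∧ ∀ w : Λ, ‖(w : ℂ)‖⁻¹ ≤ M := by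
  refine ⟨1 + ∑' w : Λ, ‖(w : ℂ)‖⁻¹ ^ 3, by positivity, fun w => ?_⟩
  have h := (lat_sum Λ).le_tsum w (fun _ _ => by positivity)
  have h0 : 0 ≤ ‖(w : ℂ)‖⁻¹ := by positivity
  set x := ‖(w : ℂ)‖⁻¹
  nlinarith [sq_nonneg (x - 1), mul_nonneg h0 (sq_nonneg (x - 1))]

lemma wE_lat_bound (r : ℝ) : ∃ u : Λ → ℝ, Summable u ∧
    ∀ w : Λ, ∀ z : ℂ, ‖z‖ ≤ r → ‖wE (z / w) - 1‖ ≤ u w := by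
  obtain ⟨M, hM, h⟩ := lat_inv_bdd Λ
  refine ⟨fun w => ‖(w : ℂ)‖⁻¹ ^ 3 * (r ^ 3 * Real.exp (r * M + (r * M) ^ 2 / 2)),
    (lat_sum Λ).mul_right _, fun w z hz => (wE_bound _).trans ?_⟩
  have hr : 0 ≤ r := (norm_nonneg z).trans hz
  have h1 : ‖z / w‖ ≤ r * ‖(w : ℂ)‖⁻¹ := by
    rw [norm_div, div_eq_mul_inv]; gcongr
  have h2 : ‖z / w‖ ≤ r * M := h1.trans (by gcongr; exact h w)
  calc _ ≤ (r * ‖(w : ℂ)‖⁻¹) ^ 3 * Real.exp (r * M + (r * M) ^ 2 / 2) := by gcongr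
    _ = _ := by ring

lemma wE_summable (z : ℂ) : Summable fun w : Λ => ‖wE (z / w) - 1‖ := by
  obtain ⟨u, hu, h⟩ := wE_lat_bound Λ ‖z‖
  exact hu.of_nonneg_of_le (fun _ => norm_nonneg _) (fun w => h w z le_rfl)

noncomputable def wP (z : ℂ) : ℂ := ∏' w : Λ, wE (z / w)

lemma wP_differentiable : Differentiable ℂ (wP Λ) := by
  intro z
  obtain ⟨u, hu, h⟩ := wE_lat_bound Λ (‖z‖ + 1)
  have hd : ∀ w : Λ, Differentiable ℂ (fun z : ℂ => wE (z / w)) := fun w =>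
    wE_differentiable.comp (differentiable_id.div_const _)
  have H := Summable.hasProdLocallyUniformlyOn_one_add (f := fun (w : Λ) z => wE (z / w) - 1)
    (K := Metric.ball (0 : ℂ) (‖z‖ + 1)) (hK := Metric.isOpen_ball) (hu := hu)
    (.of_forall fun w x hx => h w x (by simpa using (Metric.mem_ball.1 hx).le))
    (fun w => ((hd w).continuous.sub continuous_const).continuousOn)
  simp only [add_sub_cancel] at H
  have H2 : DifferentiableOn ℂ (wP Λ) (Metric.ball (0 : ℂ) (‖z‖ + 1)) :=
    H.differentiableOn
    (.of_forall fun _ ↦ by simpa [Finset.prod_fn] using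
      DifferentiableOn.finsetProd (fun w _ ↦ (hd w).differentiableOn)) Metric.isOpen_ball
  exact H2.differentiableAt (Metric.isOpen_ball.mem_nhds (by simp))

lemma wSigma_eq (z : ℂ) : wSigma Λ z = z * wP Λ z := by
  unfold wSigma wP
  congr 1
  rw [← tprod_subtype_eq_of_mulSupport_subset (s := {w : Λ | (w : ℂ) ≠ 0})]
  · refine tprod_congr fun w => ?_
    unfold wE
    congr 2
    rw [div_pow]; ring
  · intro w hw h
    apply hw
    simp [h, wE_zero]

lemma wSigma_differentiable : Differentiable ℂ (wSigma Λ) := by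
  have : wSigma Λ = fun z => z * wP Λ z := funext (wSigma_eq Λ)
  rw [this]
  exact differentiable_id.mul (wP_differentiable Λ)

lemma wSigma_zero : wSigma Λ 0 = 0 := by simp [wSigma]

lemma wSigma_deriv_zero : HasDerivAt (wSigma Λ) 1 0 := by
  have : wSigma Λ = fun z => z * wP Λ z := funext (wSigma_eq Λ)
  rw [this]
  have := (hasDerivAt_id (0 : ℂ)).mul (wP_differentiable Λ 0).hasDerivAt
  convert! this using 1
  simp [wP, wE_zero]

lemma wSigma_ne_zero {z : ℂ} (hz : z ∉ Λ) : wSigma Λ z ≠ 0 := by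
  rw [wSigma_eq]
  refine mul_ne_zero (fun h => hz (h ▸ Λ.zero_mem)) ?_
  have := tprod_one_add_ne_zero_of_summable (f := fun w : Λ => wE (z / w) - 1) (fun w => ?_)
    (wE_summable Λ z)
  · simpa [wP] using this
  · rw [add_sub_cancel]
    refine wE_ne_zero fun h => hz ?_
    rw [div_eq_one_iff_eq] at h
    · rw [h]; exact w.2
    · rintro h0
      simp [h0] at h

lemma wSigma_neg (z : ℂ) : wSigma Λ (-z) = - wSigma Λ z := by
  rw [wSigma_eq, wSigma_eq, neg_mul]
  congr 2
  unfold wP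
  rw [← (Equiv.neg Λ).tprod_eq]
  refine tprod_congr fun w => ?_
  simp

/-- all factors, including the one at 0 -/
noncomputable def wF (w z : ℂ) : ℂ := if w = 0 then z else wE (z / w)

lemma wF_summable (z : ℂ) : Summable fun w : Λ => ‖wF w z - 1‖ := by
  refine (wE_summable Λ z).congr_cofinite ?_
  have : {(0 : Λ)}ᶜ ∈ Filter.cofinite := by simp
  filter_upwards [this] with w hw
  have hw : (w : ℂ) ≠ 0 := by simpa using hw
  simp [wF, hw]

lemma wF_multipliable (z : ℂ) : Multipliable fun w : Λ => wF w z := by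
  simpa using multipliable_one_add_of_summable (wF_summable Λ z)

lemma wSigma_eq_tprod (z : ℂ) : wSigma Λ z = ∏' w : Λ, wF w z := by
  classical
  have h : Function.update (fun w : Λ => wF w z) 0 1 = fun w : Λ => wE (z / w) := by
    ext w
    by_cases hw : w = 0
    · subst hw; simp [wE_zero]
    · have hw' : (w : ℂ) ≠ 0 := by simpa using hw
      simp [wF, hw, hw']
  have hm : Multipliable (Function.update (fun w : Λ => wF w z) 0 1) := by
    rw [h]; simpa using multipliable_one_add_of_summable (wE_summable Λ z)
  rw [Multipliable.tprod_eq_mul_tprod_ite' 0 hm, wSigma_eq]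
  congr 1
  · simp [wF]
  · refine tprod_congr fun w => ?_
    have := congrFun h w
    simp only [Function.update_apply] at this
    exact this.symm

noncomputable def wA (ω w : ℂ) : ℂ := 1 / (w + ω) ^ 2 - 1 / w ^ 2
noncomputable def wB (ω w : ℂ) : ℂ := 1 / (w + ω) - 1 / w + ω / (w + ω) ^ 2

lemma lat_mixed (ω : Λ) : Summable fun w : Λ => ‖(w : ℂ)‖⁻¹ ^ 3 + ‖(w : ℂ) + ω‖⁻¹ ^ 3 := by
  refine (lat_sum Λ).add ?_
  simpa [Function.comp_def] using (Equiv.addRight ω).summable_iff.2 (lat_sum Λ)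

lemma cofin_aux (ω : Λ) : ∀ᶠ w : Λ in Filter.cofinite, (w : ℂ) ≠ 0 ∧ (w : ℂ) + ω ≠ 0 := by
  have : ({0, -ω} : Set Λ)ᶜ ∈ Filter.cofinite := (Set.toFinite _).compl_mem_cofinite
  filter_upwards [this] with w hw
  simp only [Set.mem_compl_iff, Set.mem_insert_iff, Set.mem_singleton_iff, not_or] at hw
  refine ⟨by simpa using hw.1, fun h => hw.2 ?_⟩
  rw [eq_neg_iff_add_eq_zero]
  exact Subtype.ext (by simpa using h)

lemma cube_aux {a b : ℝ} (ha : 0 ≤ a) (hb : 0 ≤ b) : a * b ^ 2 ≤ a ^ 3 + b ^ 3 := by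
  rcases le_total a b with h | h
  · have : a * b ^ 2 ≤ b * b ^ 2 := by gcongr
    nlinarith [pow_nonneg ha 3]
  · have : a * b ^ 2 ≤ a * a ^ 2 := by gcongr
    nlinarith [pow_nonneg hb 3]

lemma wB_summable (ω : Λ) : Summable fun w : Λ => wB ω w := by
  refine Summable.of_norm_bounded_eventually ((lat_mixed Λ ω).mul_left (‖(ω : ℂ)‖ ^ 2)) ?_
  filter_upwards [cofin_aux Λ ω] with w ⟨h1, h2⟩
  have : wB ω w = (ω : ℂ) ^ 2 * (-((w : ℂ)⁻¹ * ((w : ℂ) + ω)⁻¹ ^ 2)) := by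
    unfold wB; field_simp; ring
  rw [this, norm_mul, norm_pow, norm_neg, norm_mul, norm_pow, norm_inv, norm_inv]
  gcongr
  exact cube_aux (by positivity) (by positivity)

lemma wA_summable (ω : Λ) : Summable fun w : Λ => wA ω w := by
  refine Summable.of_norm_bounded_eventually ((lat_mixed Λ ω).mul_left (‖(ω : ℂ)‖ * 2)) ?_
  filter_upwards [cofin_aux Λ ω] with w ⟨h1, h2⟩
  have : wA ω w = (ω : ℂ) * (-((w : ℂ)⁻¹ * ((w : ℂ) + ω)⁻¹ ^ 2
      + ((w : ℂ) + ω)⁻¹ * (w : ℂ)⁻¹ ^ 2)) := by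
    unfold wA; field_simp; ring
  rw [this, norm_mul, norm_neg, mul_assoc]
  gcongr
  refine (norm_add_le _ _).trans ?_
  simp only [norm_mul, norm_pow, norm_inv]
  have a1 := cube_aux (a := ‖(w : ℂ)‖⁻¹) (b := ‖(w : ℂ) + ω‖⁻¹) (by positivity) (by positivity)
  have a2 := cube_aux (b := ‖(w : ℂ)‖⁻¹) (a := ‖(w : ℂ) + ω‖⁻¹) (by positivity) (by positivity)
  linarith

lemma wA_tsum (ω : Λ) : ∑' w : Λ, wA ω w = 0 := by
  have h : ∑' w : Λ, wA ω w = - ∑' w : Λ, wA ω w := by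
    conv_lhs => rw [← (Equiv.subLeft (-ω)).tsum_eq]
    rw [← tsum_neg]
    refine tsum_congr fun w => ?_
    simp only [wA, Equiv.subLeft_apply, Submodule.coe_sub, Submodule.coe_neg]
    have e1 : (-(ω : ℂ) - w + ω) ^ 2 = (w : ℂ) ^ 2 := by ring
    have e2 : (-(ω : ℂ) - w) ^ 2 = ((w : ℂ) + ω) ^ 2 := by ring
    rw [e1, e2]; ring
  exact self_eq_neg.1 h

noncomputable def wK (ω w : ℂ) : ℂ :=
  if w = 0 then -(1 / ω) * Complex.exp (1 + 1 / 2) else wF (w + ω) ω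

lemma wF_shift {ω : ℂ} (hω : ω ≠ 0) (w z : ℂ) :
    wF (w + ω) (z + ω) = wF w z * Complex.exp (z ^ 2 / 2 * wA ω w + z * wB ω w) * wK ω w := by
  by_cases h1 : w = 0
  · subst h1
    simp only [wF, wK, zero_add, hω, if_true, if_false, wE, wA, wB]
    rw [mul_assoc, mul_comm (Complex.exp _), mul_assoc (-(1 / ω)), ← Complex.exp_add]
    rw [← mul_assoc]
    congr 1
    · field_simp; ring
    · congr 1; field_simp; ring
  by_cases h2 : w + ω = 0
  · have h3 : ω = -w := by linear_combination h2
    subst h3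
    simp only [wF, wK, h1, add_neg_cancel, if_true, if_false, wE, wA, wB]
    have : Complex.exp (z / w + (z / w) ^ 2 / 2) * Complex.exp (z ^ 2 / 2 * (1 / 0 ^ 2 - 1 / w ^ 2) +
       z * (1 / 0 - 1 / w + -w / 0 ^ 2)) = 1 := by
      rw [← Complex.exp_add, Complex.exp_eq_one_iff]
      use 0
      field_simp
      simp
    rw [mul_assoc (1 - z / w), this]
    field_simp
    ring
  · simp only [wF, wK, h1, h2, if_false, wE, wA, wB]
    set a := Complex.exp (z / w + (z / w) ^ 2 / 2) with ha
    rw [show (1 - z / w) * a * Complex.exp (z ^ 2 / 2 * (1 / (w + ω) ^ 2 - 1 / w ^ 2) +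
        z * (1 / (w + ω) - 1 / w + ω / (w + ω) ^ 2)) * ((1 - ω / (w + ω)) *
        Complex.exp (ω / (w + ω) + (ω / (w + ω)) ^ 2 / 2))
      = ((1 - z / w) * (1 - ω / (w + ω))) * (a * Complex.exp (z ^ 2 / 2 * (1 / (w + ω) ^ 2 - 1 / w ^ 2) +
        z * (1 / (w + ω) - 1 / w + ω / (w + ω) ^ 2)) *
        Complex.exp (ω / (w + ω) + (ω / (w + ω)) ^ 2 / 2)) by ring, ha, ← Complex.exp_add,
        ← Complex.exp_add]
    congr 1
    · field_simp; ring
    · congr 1; field_simp; ring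

lemma wK_multipliable (ω : Λ) : Multipliable fun w : Λ => wK ω w := by
  have h : Summable fun w : Λ => ‖wK ω w - 1‖ := by
    have h0 : Summable fun w : Λ => ‖wF ((w : ℂ) + ω) ω - 1‖ := by
      simpa [Function.comp_def] using (Equiv.addRight ω).summable_iff.2 (wF_summable Λ ω)
    refine h0.congr_cofinite ?_
    filter_upwards [cofin_aux Λ ω] with w ⟨h1, h2⟩
    simp [wK, h1]
  simpa using multipliable_one_add_of_summable h

lemma wSigma_quasi (ω : ℂ) (hω : ω ∈ Λ) :
    ∃ c η : ℂ, c ≠ 0 ∧ ∀ z, wSigma Λ (z + ω) = c * Complex.exp (η * z) * wSigma Λ z := by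
  by_cases h0 : ω = 0
  · exact ⟨1, 0, one_ne_zero, fun z => by simp [h0]⟩
  lift ω to Λ using hω
  have key : ∀ z, wSigma Λ (z + ω) = (∏' w : Λ, wK ω w) *
      Complex.exp ((∑' w : Λ, wB ω w) * z) * wSigma Λ z := by
    intro z
    have hs : HasSum (fun w : Λ => z ^ 2 / 2 * wA ω w + z * wB ω w)
        (z ^ 2 / 2 * 0 + z * ∑' w : Λ, wB ω w) := by
      rw [← wA_tsum Λ ω]
      exact ((wA_summable Λ ω).hasSum.mul_left _).add ((wB_summable Λ ω).hasSum.mul_left _)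
    have hp := hs.cexp
    have H := ((wF_multipliable Λ z).hasProd.mul hp).mul (wK_multipliable Λ ω).hasProd
    rw [wSigma_eq_tprod Λ (z + ω), ← (Equiv.addRight ω).tprod_eq, wSigma_eq_tprod Λ z]
    have e : (fun w : Λ => wF (((Equiv.addRight ω) w : Λ) : ℂ) (z + ω)) =
      fun w : Λ => wF w z * (Complex.exp ∘ fun w : Λ => z ^ 2 / 2 * wA ω w + z * wB ω w) w * wK ω w := by
      ext w
      simpa using wF_shift h0 w z
    rw [e, H.tprod_eq, mul_zero, zero_add, mul_comm z]
    ring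
  refine ⟨_, _, ?_, key⟩
  intro hc
  obtain ⟨z, hz⟩ : ∃ z, z ∉ Λ := by
    by_contra! h
    exact not_countable_complex ((lat_countable Λ).mono fun z _ => h z)
  have := key z
  rw [hc, zero_mul, zero_mul] at this
  refine wSigma_ne_zero Λ (fun h => hz ?_) this
  simpa using Λ.sub_mem h ω.2

lemma wSigma_eq_zero {z : ℂ} (hz : z ∈ Λ) : wSigma Λ z = 0 := by
  obtain ⟨c, η, -, h⟩ := wSigma_quasi Λ z hz
  have := h 0
  rwa [wSigma_zero, mul_zero, zero_add] at this

lemma wSigma_deriv_ne {z : ℂ} (hz : z ∈ Λ) : deriv (wSigma Λ) z ≠ 0 := by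
  obtain ⟨c, η, hc, h⟩ := wSigma_quasi Λ z hz
  have h1 : HasDerivAt (fun x => wSigma Λ (x + z)) (deriv (wSigma Λ) z) 0 := by
    have : HasDerivAt (wSigma Λ) (deriv (wSigma Λ) z) (0 + z) := by
      rw [zero_add]; exact (wSigma_differentiable Λ z).hasDerivAt
    exact this.comp_add_const 0 z
  have h2 : HasDerivAt (fun x => wSigma Λ (x + z)) c 0 := by
    rw [funext h]
    have h3 : HasDerivAt (fun x => c * Complex.exp (η * x)) (c * (Complex.exp (η * 0) * (η * 1))) 0 :=
      (((hasDerivAt_id (0 : ℂ)).const_mul η).cexp).const_mul c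
    have := h3.mul (wSigma_deriv_zero Λ)
    convert! this using 1
    simp [wSigma_zero]
  rw [h1.unique h2]
  exact hc

end lat

lemma lat_liouville (Λ : Submodule ℤ ℂ) [DiscreteTopology Λ] [IsZLattice ℝ Λ]
    {F h : ℂ → ℂ} (hF : Differentiable ℂ F) (hh : Differentiable ℂ h)
    (hz : ∀ a, h a = 0 → F a = 0 ∧ deriv h a ≠ 0)
    (hd : Dense {a | h a ≠ 0})
    (hper : ∀ ω ∈ Λ, ∃ m : ℂ → ℂ, ∀ a, m a ≠ 0 ∧ F (a + ω) = m a * F a ∧ h (a + ω) = m a * h a) :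
    ∃ k, ∀ a, F a = k * h a := by
  classical
  let G : ℂ → ℂ := fun a => if h a = 0 then deriv F a / deriv h a else F a / h a
  have hG : Differentiable ℂ G := by
    intro a
    by_cases ha : h a = 0
    · obtain ⟨hFa, hda⟩ := hz a ha
      have d1 : Differentiable ℂ (dslope F a) := by
        rw [← differentiableOn_univ] at hF ⊢
        exact (Complex.differentiableOn_dslope Filter.univ_mem).2 hF
      have d2 : Differentiable ℂ (dslope h a) := by
        rw [← differentiableOn_univ] at hh ⊢
        exact (Complex.differentiableOn_dslope Filter.univ_mem).2 hh
      have hne : dslope h a a ≠ 0 := by rwa [dslope_same]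
      refine ((d1 a).div (d2 a) hne).congr_of_eventuallyEq ?_
      filter_upwards [(d2 a).continuousAt.eventually_ne hne] with x hx
      by_cases hxa : x = a
      · subst hxa
        simp [G, ha]
      · have hxa' : x - a ≠ 0 := sub_ne_zero.2 hxa
        rw [dslope_of_ne _ hxa, slope_def_field, ha, sub_zero] at hx
        have hx0 : h x ≠ 0 := fun h0 => hx (by simp [h0])
        simp only [G, hx0, if_false, Pi.div_apply]
        rw [dslope_of_ne _ hxa, dslope_of_ne _ hxa, slope_def_field, slope_def_field, ha, hFa]
        field_simp
        simp [mul_comm]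
    · refine ((hF a).div (hh a) ha).congr_of_eventuallyEq ?_
      filter_upwards [(hh a).continuousAt.eventually_ne ha] with x hx
      simp [G, hx]
  have hGp : ∀ z w, w ∈ Λ → G (z + w) = G z := by
    intro z w hw
    obtain ⟨m, hm⟩ := hper w hw
    refine congrFun (Continuous.ext_on (f := fun z => G (z + w)) (g := G) hd
      (hG.continuous.comp (continuous_id.add continuous_const)) hG.continuous ?_) z
    intro a ha
    obtain ⟨h1, h2, h3⟩ := hm a
    have ha : h a ≠ 0 := ha
    have h4 : h (a + w) ≠ 0 := by rw [h3]; exact mul_ne_zero h1 ha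
    simp only [G, ha, h4, if_false]
    rw [h2, h3]
    field_simp
  have hc := fun x => hG.apply_eq_apply_of_bounded
    (IsZLattice.isCompact_range_of_periodic Λ G hG.continuous hGp).isBounded x 0
  refine ⟨G 0, fun a => ?_⟩
  rw [← hc a]
  by_cases ha : h a = 0
  · simp [ha, (hz a ha).1]
  · simp [G, ha]

section lat2
variable (Λ : Submodule ℤ ℂ) [DiscreteTopology Λ] [IsZLattice ℝ Λ]

lemma wSigma_eq_zero_iff {z : ℂ} : wSigma Λ z = 0 ↔ z ∈ Λ :=
  ⟨fun h => by by_contra hz; exact wSigma_ne_zero Λ hz h, wSigma_eq_zero Λ⟩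

noncomputable def wT (a b c s : ℂ) : ℂ :=
  wSigma Λ (a + b + s) * wSigma Λ (a - b) * wSigma Λ (c + s) * wSigma Λ c

lemma dense_aux (t u : ℂ) (ht : t ≠ 0) : ({x : ℂ | t * x + u ∈ Λ} : Set ℂ).Countable := by
  refine (lat_countable Λ).preimage_of_injOn (f := fun x => t * x + u) ?_
  intro x _ y _ hxy
  simpa [ht] using hxy

lemma wT_generic (b c s : ℂ) (h1 : 2 * b + s ∉ Λ) (h2 : c + b + s ∉ Λ) (h3 : c - b ∉ Λ) (a : ℂ) :
    wT Λ a b c s + wT Λ b c a s + wT Λ c a b s = 0 := by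
  have hσ := wSigma_differentiable Λ
  have hneg : ∀ x y, wSigma Λ (x - y) = - wSigma Λ (y - x) := fun x y => by
    rw [← wSigma_neg, neg_sub]
  let h : ℂ → ℂ := fun a => wSigma Λ (a + b + s) * wSigma Λ (a - b)
  let F : ℂ → ℂ := fun a => wT Λ a b c s + wT Λ b c a s + wT Λ c a b s
  have hh : Differentiable ℂ h := by
    unfold h
    exact (hσ.comp (by fun_prop : Differentiable ℂ fun a : ℂ => a + b + s)).mul
      (hσ.comp (by fun_prop : Differentiable ℂ fun a : ℂ => a - b))
  have hF : Differentiable ℂ F := by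
    unfold F wT
    have k1 := hσ.comp (by fun_prop : Differentiable ℂ fun a : ℂ => a + s)
    have k2 := hσ.comp (by fun_prop : Differentiable ℂ fun a : ℂ => c + a + s)
    have k3 := hσ.comp (by fun_prop : Differentiable ℂ fun a : ℂ => c - a)
    exact (((hh.mul_const _).mul_const _).add ((k1.const_mul _).mul hσ)).add
      (((k2.mul k3).mul_const _).mul_const _)
  have hper : ∀ ω ∈ Λ, ∃ m : ℂ → ℂ, ∀ a, m a ≠ 0 ∧ F (a + ω) = m a * F a ∧
      h (a + ω) = m a * h a := by
    intro ω hω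
    obtain ⟨k, η, hk, hq⟩ := wSigma_quasi Λ ω hω
    have hq2 : ∀ x y, wSigma Λ (x + ω) * wSigma Λ (y + ω) =
        k ^ 2 * Complex.exp (η * (x + y)) * (wSigma Λ x * wSigma Λ y) := by
      intro x y
      rw [hq, hq, mul_add, Complex.exp_add]; ring
    have e1 : ∀ a, h (a + ω) = k ^ 2 * Complex.exp (η * (2 * a + s)) * h a := by
      intro a
      have := hq2 (a + b + s) (a - b)
      rw [show a + b + s + ω = a + ω + b + s by ring, show a - b + ω = a + ω - b by ring,
        show a + b + s + (a - b) = 2 * a + s by ring] at this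
      exact this
    have e2 : ∀ a, wSigma Λ (a + ω + s) * wSigma Λ (a + ω) =
        k ^ 2 * Complex.exp (η * (2 * a + s)) * (wSigma Λ (a + s) * wSigma Λ a) := by
      intro a
      have := hq2 (a + s) a
      rwa [show a + s + ω = a + ω + s by ring,
        show a + s + a = 2 * a + s by ring] at this
    have e3 : ∀ a, wSigma Λ (c + (a + ω) + s) * wSigma Λ (c - (a + ω)) =
        k ^ 2 * Complex.exp (η * (2 * a + s)) * (wSigma Λ (c + a + s) * wSigma Λ (c - a)) := by
      intro a
      have := hq2 (c + a + s) (a - c)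
      rw [show c + a + s + ω = c + (a + ω) + s by ring, show a - c + ω = a + ω - c by ring,
        show c + a + s + (a - c) = 2 * a + s by ring] at this
      rw [hneg c, hneg c]
      linear_combination - this
    refine ⟨fun a => k ^ 2 * Complex.exp (η * (2 * a + s)), fun a =>
      ⟨mul_ne_zero (pow_ne_zero _ hk) (Complex.exp_ne_zero _), ?_, e1 a⟩⟩
    have e1 := e1 a
    have e2 := e2 a
    have e3 := e3 a
    simp only [h] at e1
    simp only [F, wT]
    linear_combination (wSigma Λ (c + s) * wSigma Λ c) * e1 +
      (wSigma Λ (b + c + s) * wSigma Λ (b - c)) * e2 + (wSigma Λ (b + s) * wSigma Λ b) * e3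
  have hFb : F b = 0 := by
    simp only [F, wT, sub_self, wSigma_zero]
    rw [hneg c b, show c + b + s = b + c + s by ring]; ring
  have hFb' : F (-b - s) = 0 := by
    simp only [F, wT]
    rw [show -b - s + b + s = 0 by ring, wSigma_zero, show -b - s + s = -b by ring,
      show -b - s = -(b + s) by ring, show c + -(b + s) + s = -(b - c) by ring,
      show c - -(b + s) = b + c + s by ring, wSigma_neg, wSigma_neg, wSigma_neg]
    ring
  have hFshift : ∀ x ω, ω ∈ Λ → F x = 0 → F (x + ω) = 0 := by
    intro x ω hω hx
    obtain ⟨m, hm⟩ := hper ω hω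
    rw [(hm x).2.1, hx, mul_zero]
  have hderiv : ∀ a, deriv h a = deriv (wSigma Λ) (a + b + s) * wSigma Λ (a - b)
      + wSigma Λ (a + b + s) * deriv (wSigma Λ) (a - b) := by
    intro a
    have l1 : HasDerivAt (fun a => wSigma Λ (a + b + s)) (deriv (wSigma Λ) (a + b + s)) a := by
      have := (hσ (a + (b + s))).hasDerivAt.comp_add_const a (b + s)
      simpa only [add_assoc] using this
    have l2 : HasDerivAt (fun a => wSigma Λ (a - b)) (deriv (wSigma Λ) (a - b)) a :=
      (hσ (a - b)).hasDerivAt.comp_sub_const a b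
    exact (l1.mul l2).deriv
  have hzero : ∀ a, h a = 0 → F a = 0 ∧ deriv h a ≠ 0 := by
    intro a ha
    rw [hderiv]
    rcases mul_eq_zero.1 ha with h0 | h0
    · rw [wSigma_eq_zero_iff] at h0
      have hn : a - b ∉ Λ := fun hm => h1 (by
        have := Λ.sub_mem h0 hm
        rwa [show a + b + s - (a - b) = 2 * b + s by ring] at this)
      constructor
      · have := hFshift (-b - s) _ h0 hFb'
        rwa [show -b - s + (a + b + s) = a by ring] at this
      · rw [wSigma_eq_zero Λ h0, zero_mul, add_zero]
        exact mul_ne_zero (wSigma_deriv_ne Λ h0) (wSigma_ne_zero Λ hn)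
    · rw [wSigma_eq_zero_iff] at h0
      have hn : a + b + s ∉ Λ := fun hm => h1 (by
        have := Λ.sub_mem hm h0
        rwa [show a + b + s - (a - b) = 2 * b + s by ring] at this)
      constructor
      · have := hFshift b _ h0 hFb
        rwa [show b + (a - b) = a by ring] at this
      · rw [wSigma_eq_zero Λ h0, mul_zero, zero_add]
        exact mul_ne_zero (wSigma_ne_zero Λ hn) (wSigma_deriv_ne Λ h0)
  have hdense : Dense {a | h a ≠ 0} := by
    have hcount : {a | h a = 0}.Countable := by
      refine ((dense_aux Λ 1 (b + s) one_ne_zero).union (dense_aux Λ 1 (-b) one_ne_zero)).mono ?_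
      intro a ha
      rcases mul_eq_zero.1 ha with h0 | h0
      · left
        rw [wSigma_eq_zero_iff] at h0
        simpa [add_assoc] using h0
      · right
        rw [wSigma_eq_zero_iff] at h0
        simpa [sub_eq_add_neg] using h0
    exact hcount.dense_compl ℝ
  obtain ⟨k, hk⟩ := lat_liouville Λ hF hh hzero hdense hper
  have hFc : F c = 0 := by
    simp only [F, wT, sub_self, wSigma_zero]
    rw [hneg c b, show c + b + s = b + c + s by ring]; ring
  have hhc : h c ≠ 0 := mul_ne_zero (wSigma_ne_zero Λ h2) (wSigma_ne_zero Λ h3)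
  have hk0 : k = 0 := by
    have := hk c
    rw [hFc] at this
    exact (mul_eq_zero.1 this.symm).resolve_right hhc
  have := hk a
  rwa [hk0, zero_mul] at this

lemma wT_identity (a b c s : ℂ) :
    wT Λ a b c s + wT Λ b c a s + wT Λ c a b s = 0 := by
  have hσ := (wSigma_differentiable Λ).continuous
  have hcount := ((dense_aux Λ 2 s two_ne_zero).union (dense_aux Λ 1 (c + s) one_ne_zero)).union
    (dense_aux Λ (-1) c (by norm_num))
  have hd := hcount.dense_compl ℝ
  refine congrFun (Continuous.ext_on (f := fun b => wT Λ a b c s + wT Λ b c a s + wT Λ c a b s)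
    (g := fun _ => 0) hd ?_ continuous_const ?_) b
  · unfold wT; fun_prop
  · intro b hb
    simp only [Set.mem_compl_iff, Set.mem_union, not_or, Set.mem_setOf_eq] at hb
    refine wT_generic Λ b c s hb.1.1 ?_ ?_ a
    · convert hb.1.2 using 2; ring
    · convert hb.2 using 2; ring

end lat2

noncomputable def wD (Λ : Submodule ℤ ℂ) {n : ℕ} (z : Fin n → ℂ) (v : Fin n → ℤ) : ℂ :=
  (∏ i, wSigma Λ (z i) ^ (2 * v i ^ 2 - ∑ j, v i * v j)) *
    ∏ p ∈ Finset.univ.filter (fun p : Fin n × Fin n => p.1 < p.2),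
      wSigma Λ (z p.1 + z p.2) ^ (v p.1 * v p.2)

lemma OmegaNet_eq (Λ : Submodule ℤ ℂ) {n : ℕ} (z : Fin n → ℂ) (v : Fin n → ℤ) :
    OmegaNet Λ z v = wSigma Λ (∑ i, (v i : ℂ) * z i) / wD Λ z v := by
  unfold OmegaNet
  split_ifs with h
  · subst h; simp [wSigma]
  · rfl

lemma wD_four (Λ : Submodule ℤ ℂ) {n : ℕ} (z : Fin n → ℂ)
    (hz : ∀ i, wSigma Λ (z i) ≠ 0)
    (hz2 : ∀ i j : Fin n, i ≠ j → wSigma Λ (z i + z j) ≠ 0) (v1 v2 v3 v4 : Fin n → ℤ) :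
    wD Λ z v1 * wD Λ z v2 * wD Λ z v3 * wD Λ z v4 =
    (∏ i, wSigma Λ (z i) ^ (∑ j, ((if j = i then 2 else 0) - 1) *
      (v1 i * v1 j + v2 i * v2 j + v3 i * v3 j + v4 i * v4 j))) *
    ∏ p ∈ Finset.univ.filter (fun p : Fin n × Fin n => p.1 < p.2),
      wSigma Λ (z p.1 + z p.2) ^
        (v1 p.1 * v1 p.2 + v2 p.1 * v2 p.2 + v3 p.1 * v3 p.2 + v4 p.1 * v4 p.2) := by
  unfold wD
  have e1 : ∀ a b c d e f g h : ℂ, (a * b) * (c * d) * (e * f) * (g * h) =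
    (a * c * e * g) * (b * d * f * h) := by intros; ring
  rw [e1]
  simp only [← Finset.prod_mul_distrib]
  congr 1
  · refine Finset.prod_congr rfl fun i _ => ?_
    rw [← zpow_add₀ (hz i), ← zpow_add₀ (hz i), ← zpow_add₀ (hz i)]
    congr 1
    simp only [sub_mul, Finset.sum_sub_distrib, ite_mul, zero_mul, Finset.sum_ite_eq',
      Finset.mem_univ, if_true, one_mul, Finset.sum_add_distrib]
    ring
  · refine Finset.prod_congr rfl fun p hp => ?_
    have := hz2 p.1 p.2 (ne_of_lt (Finset.mem_filter.1 hp).2)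
    rw [← zpow_add₀ this, ← zpow_add₀ this, ← zpow_add₀ this]

lemma wD_cyc (Λ : Submodule ℤ ℂ) {n : ℕ} (z : Fin n → ℂ)
    (hz : ∀ i, wSigma Λ (z i) ≠ 0)
    (hz2 : ∀ i j : Fin n, i ≠ j → wSigma Λ (z i + z j) ≠ 0) (p q r s : Fin n → ℤ) :
    wD Λ z (q + r + s) * wD Λ z (q - r) * wD Λ z (p + s) * wD Λ z p =
    wD Λ z (p + q + s) * wD Λ z (p - q) * wD Λ z (r + s) * wD Λ z r := by
  rw [wD_four Λ z hz hz2, wD_four Λ z hz hz2]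
  congr 1
  · refine Finset.prod_congr rfl fun i _ => ?_
    congr 1
    refine Finset.sum_congr rfl fun j _ => ?_
    simp only [Pi.add_apply, Pi.sub_apply]
    ring
  · refine Finset.prod_congr rfl fun x _ => ?_
    congr 1
    simp only [Pi.add_apply, Pi.sub_apply]
    ring

theorem omegaNet_is_elliptic_net (Λ : Submodule ℤ ℂ) [DiscreteTopology Λ]
    [IsZLattice ℝ Λ] {n : ℕ} (z : Fin n → ℂ)
    (hz : ∀ i, wSigma Λ (z i) ≠ 0)
    (hz2 : ∀ i j : Fin n, i ≠ j → wSigma Λ (z i + z j) ≠ 0) :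
    ∀ p q r s : Fin n → ℤ,
      OmegaNet Λ z (p + q + s) * OmegaNet Λ z (p - q) * OmegaNet Λ z (r + s) *
          OmegaNet Λ z r +
        OmegaNet Λ z (q + r + s) * OmegaNet Λ z (q - r) * OmegaNet Λ z (p + s) *
          OmegaNet Λ z p +
        OmegaNet Λ z (r + p + s) * OmegaNet Λ z (r - p) * OmegaNet Λ z (q + s) *
          OmegaNet Λ z q = 0 := by
  intro p q r s
  have hT := wT_identity Λ (∑ i, (p i : ℂ) * z i) (∑ i, (q i : ℂ) * z i) (∑ i, (r i : ℂ) * z i)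
    (∑ i, (s i : ℂ) * z i)
  have c1 := wD_cyc Λ z hz hz2 p q r s
  have c2 := wD_cyc Λ z hz hz2 q r p s
  simp only [OmegaNet_eq, div_mul_div_comm]
  rw [c2, c1, ← add_div, ← add_div]
  simp only [Pi.add_apply, Pi.sub_apply, Int.cast_add, Int.cast_sub, add_mul, sub_mul,
    Finset.sum_add_distrib, Finset.sum_sub_distrib]
  unfold wT at hT
  rw [hT, zero_div]
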